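/- arXiv:math/0311125 — 3 statements merged into one kernel-verified Lean document; each statement's English description precedes it below -/
import Mathlib

section
/- Let T be a locally finite rooted tree with root o, let k ≥ 2, and let x be a vertex of T with |L_R(x)| < (k-1)·k^{R-1} for some positive integer R, where L_r(x) denotes the set of descendants of x at distance exactly r from x. Then the union ⋃_{0 ≤ r ≤ R} L_r(x) contains a (k-1)-fort of T. -/
variable {V : Type*}

/-- A `j`-fort in a graph: a nonempty connected set of vertices each of which has
at most `j` neighbors outside the set. -/
def SimpleGraph.IsFort (G : SimpleGraph V) (j : ℕ) (F : Set V) : Prop :=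
  F.Nonempty ∧ (G.induce F).Connected ∧
    ∀ v ∈ F, {w | G.Adj v w ∧ w ∉ F}.ncard ≤ j

/-- `L r x`: the descendants of `x` (in the tree rooted at `o`) at distance exactly
`r` below `x`; i.e. vertices `y` whose shortest path to `o` passes through `x`
and with `dist o y = dist o x + r`. -/
def SimpleGraph.descLevel (G : SimpleGraph V) (o x : V) (r : ℕ) : Set V :=
  {y | G.dist o y = G.dist o x + G.dist x y ∧ G.dist x y = r}

namespace SimpleGraph

/-- The children of `p` in the graph rooted at `o`. -/
def rootedChildren (G : SimpleGraph V) (o p : V) : Set V :=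
  {v | G.Adj p v ∧ G.dist o v = G.dist o p + 1}

variable {G : SimpleGraph V} {o : V}

/-- A vertex of a tree has at most one parent. -/
lemma IsTree.eq_of_mem_rootedChildren (hG : G.IsTree) {p q v : V}
    (hp : v ∈ G.rootedChildren o p) (hq : v ∈ G.rootedChildren o q) : p = q := by
  have key : ∀ {u}, v ∈ G.rootedChildren o u →
      ∃ w : G.Walk o v, w.IsPath ∧ w.penultimate = u := by
    rintro u ⟨huv, hd⟩
    obtain ⟨w, hw⟩ := hG.connected.exists_walk_length_eq_dist o u
    refine ⟨w.concat huv, Walk.isPath_of_length_eq_dist _ ?_, by simp⟩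
    rw [Walk.length_concat, hw, hd]
  obtain ⟨w, hw, rfl⟩ := key hp
  obtain ⟨w', hw', rfl⟩ := key hq
  rw [(hG.existsUnique_path o v).unique hw hw']

lemma finite_rootedChildren [G.LocallyFinite] (o p : V) : (G.rootedChildren o p).Finite :=
  (G.neighborSet p).toFinite.subset fun _ h => h.1

lemma Connected.descLevel_zero (hG : G.Connected) (o x : V) : G.descLevel o x 0 = {x} := by
  ext y
  simp only [descLevel, hG.dist_eq_zero_iff, Set.mem_ofPred_eq, Set.mem_singleton_iff]
  constructor
  · rintro ⟨-, rfl⟩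
    rfl
  · rintro rfl
    simp

lemma Connected.descLevel_subset_of_mem_rootedChildren (hG : G.Connected) {x c : V}
    (hc : c ∈ G.rootedChildren o x) (n : ℕ) :
    G.descLevel o c n ⊆ G.descLevel o x (n + 1) := by
  rintro y ⟨h₁, h₂⟩
  obtain ⟨hadj, hd⟩ := hc
  have hxc : G.dist x c = 1 := dist_eq_one_iff_adj.2 hadj
  have h₃ := hG.dist_triangle (u := o) (v := x) (w := y)
  have h₄ := hG.dist_triangle (u := x) (v := c) (w := y)
  constructor <;> omega

lemma Connected.exists_mem_descLevel_of_mem_succ (hG : G.Connected) {x y : V} {n : ℕ}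
    (hy : y ∈ G.descLevel o x (n + 1)) :
    ∃ z ∈ G.descLevel o x n, y ∈ G.rootedChildren o z := by
  obtain ⟨h₁, h₂⟩ := hy
  obtain ⟨w, hw⟩ := hG.exists_walk_length_eq_dist x y
  have hnil : ¬ w.Nil := by
    rw [← Walk.length_eq_zero_iff]
    omega
  have hadj := w.adj_penultimate hnil
  have hzy : G.dist w.penultimate y = 1 := dist_eq_one_iff_adj.2 hadj
  have hxz : G.dist x w.penultimate ≤ n := by
    have := dist_le w.dropLast
    rw [Walk.length_dropLast] at this
    omega
  have h₃ := hG.dist_triangle (u := x) (v := w.penultimate) (w := y)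
  have h₄ := hG.dist_triangle (u := o) (v := w.penultimate) (w := y)
  have h₅ := hG.dist_triangle (u := o) (v := x) (w := w.penultimate)
  refine ⟨w.penultimate, ⟨?_, ?_⟩, hadj, ?_⟩ <;> omega

lemma Connected.finite_descLevel [G.LocallyFinite] (hG : G.Connected) (o x : V) (n : ℕ) :
    (G.descLevel o x n).Finite := by
  induction n with
  | zero =>
    rw [hG.descLevel_zero]
    exact Set.finite_singleton x
  | succ n ih =>
    refine (ih.biUnion fun z _ => finite_rootedChildren (G := G) o z).subset fun y hy => ?_
    simpa using hG.exists_mem_descLevel_of_mem_succ hy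

/-- A vertex of a tree has at most one ancestor at each distance. -/
lemma IsTree.eq_of_mem_descLevel (hG : G.IsTree) {c c' y : V} {n : ℕ}
    (h : y ∈ G.descLevel o c n) (h' : y ∈ G.descLevel o c' n) : c = c' := by
  induction n generalizing y with
  | zero =>
    rw [hG.connected.descLevel_zero] at h h'
    exact h.symm.trans h'
  | succ n ih =>
    obtain ⟨z, hz, hzy⟩ := hG.connected.exists_mem_descLevel_of_mem_succ h
    obtain ⟨z', hz', hzy'⟩ := hG.connected.exists_mem_descLevel_of_mem_succ h'
    obtain rfl := hG.eq_of_mem_rootedChildren hzy hzy'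
    exact ih hz hz'

/-- If each child in `N` has at least `m` descendants `n` levels below it, then `x` has at least
`|N| * m` descendants `n + 1` levels below it. -/
lemma IsTree.ncard_mul_le_ncard_descLevel_succ [G.LocallyFinite] (hG : G.IsTree) {x : V}
    {N : Set V} (hN : N ⊆ G.rootedChildren o x) {n m : ℕ}
    (hm : ∀ c ∈ N, m ≤ (G.descLevel o c n).ncard) :
    N.ncard * m ≤ (G.descLevel o x (n + 1)).ncard := by
  classical
  have hNfin : N.Finite := (finite_rootedChildren o x).subset hN
  have hfin := hG.connected.finite_descLevel o
  calc N.ncard * m = hNfin.toFinset.card • m := by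
        rw [Set.ncard_eq_toFinset_card N hNfin, smul_eq_mul]
    _ ≤ ∑ c ∈ hNfin.toFinset, (hfin c n).toFinset.card := by
        refine Finset.card_nsmul_le_sum _ _ _ fun c hc => ?_
        rw [← Set.ncard_eq_toFinset_card _ (hfin c n)]
        exact hm c (hNfin.mem_toFinset.1 hc)
    _ = (hNfin.toFinset.biUnion fun c => (hfin c n).toFinset).card := by
        refine (Finset.card_biUnion fun c _ c' _ hne => ?_).symm
        refine Finset.disjoint_left.2 fun y hy hy' => hne (hG.eq_of_mem_descLevel ((hfin c n).mem_toFinset.1 hy)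
            ((hfin c' n).mem_toFinset.1 hy'))
    _ ≤ (hfin x (n + 1)).toFinset.card := by
        refine Finset.card_le_card fun y hy => ?_
        simp only [Finset.mem_biUnion, Set.Finite.mem_toFinset] at hy ⊢
        obtain ⟨c, hc, hy⟩ := hy
        exact hG.connected.descLevel_subset_of_mem_rootedChildren (hN hc) n hy
    _ = (G.descLevel o x (n + 1)).ncard := (Set.ncard_eq_toFinset_card _ _).symm

/-- `F` is a subtree with top vertex `x` inside the first `n` levels below `x`, in which `x` misses
at most `i` of its children and every other vertex misses at most `j` of its children. -/
structure IsDescFort (G : SimpleGraph V) (o : V) (n i j : ℕ) (x : V) (F : Set V) : Prop where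
  mem : x ∈ F
  subset : F ⊆ ⋃ r ∈ Finset.range (n + 1), G.descLevel o x r
  parent : ∀ v ∈ F, v = x ∨ ∃ p ∈ F, v ∈ G.rootedChildren o p
  top : (G.rootedChildren o x \ F).ncard ≤ i
  other : ∀ v ∈ F, v = x ∨ (G.rootedChildren o v \ F).ncard ≤ j

lemma IsTree.exists_isDescFort_succ [G.LocallyFinite] (hG : G.IsTree) {x : V} {n i j m : ℕ}
    (ih : ∀ c, (G.descLevel o c n).ncard < m → ∃ F, G.IsDescFort o n j j c F)
    (hsmall : (G.descLevel o x (n + 1)).ncard < (i + 1) * m) :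
    ∃ F, G.IsDescFort o (n + 1) i j x F := by
  choose! S hS using ih
  set A : Set V := {c ∈ G.rootedChildren o x | (G.descLevel o c n).ncard < m}
  have hSA : ∀ c ∈ A, S c ⊆ insert x (⋃ c ∈ A, S c) := fun c hc =>
    (Set.subset_biUnion_of_mem (u := S) hc).trans (Set.subset_insert _ _)
  refine ⟨insert x (⋃ c ∈ A, S c), Set.mem_insert _ _, ?_, ?_, ?_, ?_⟩
  · refine Set.insert_subset ?_ (Set.iUnion₂_subset fun c hc y hy => ?_)
    · refine Set.mem_biUnion (x := 0) (by simp) ?_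
      simp [hG.connected.descLevel_zero]
    · obtain ⟨r, hr, hy⟩ := Set.mem_iUnion₂.1 ((hS c hc.2).subset hy)
      refine Set.mem_biUnion (x := r + 1) ?_
        (hG.connected.descLevel_subset_of_mem_rootedChildren hc.1 r hy)
      simp only [Finset.coe_range, Set.mem_Iio, Finset.mem_range] at hr ⊢
      omega
  · rintro v (rfl | hv)
    · exact Or.inl rfl
    · right
      obtain ⟨c, hc, hv⟩ := Set.mem_iUnion₂.1 hv
      obtain rfl | ⟨p, hp, hvp⟩ := (hS c hc.2).parent v hv
      · exact ⟨x, Set.mem_insert _ _, hc.1⟩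
      · exact ⟨p, hSA c hc hp, hvp⟩
  · set N : Set V := G.rootedChildren o x \ insert x (⋃ c ∈ A, S c)
    have hle := hG.ncard_mul_le_ncard_descLevel_succ (o := o) (x := x) (N := N)
      Set.sdiff_subset (n := n) (m := m) fun c hc => by
        by_contra! hlt
        exact hc.2 (hSA c ⟨hc.1, hlt⟩ (hS c hlt).mem)
    exact Nat.lt_succ_iff.1 (Nat.lt_of_mul_lt_mul_right (hle.trans_lt hsmall))
  · rintro v (rfl | hv)
    · exact Or.inl rfl
    · right
      obtain ⟨c, hc, hv⟩ := Set.mem_iUnion₂.1 hv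
      refine (Set.ncard_le_ncard (Set.sdiff_subset_sdiff_right (hSA c hc))
        ((finite_rootedChildren o v).subset Set.sdiff_subset)).trans ?_
      obtain rfl | h := (hS c hc.2).other v hv
      · exact (hS v hc.2).top
      · exact h

lemma IsTree.exists_isDescFort [G.LocallyFinite] (hG : G.IsTree) {j n : ℕ} (x : V)
    (hsmall : (G.descLevel o x n).ncard < (j + 1) ^ n) :
    ∃ F, G.IsDescFort o n j j x F := by
  induction n generalizing x with
  | zero => simp [hG.connected.descLevel_zero] at hsmall
  | succ n ih => exact hG.exists_isDescFort_succ ih (by rwa [pow_succ'] at hsmall)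

lemma IsDescFort.connected {x : V} {n i j : ℕ} {F : Set V} (hF : G.IsDescFort o n i j x F) :
    (G.induce F).Connected := by
  have hreach : ∀ d v (hv : v ∈ F), G.dist o v = d →
      (G.induce F).Reachable ⟨x, hF.mem⟩ ⟨v, hv⟩ := by
    intro d
    induction d using Nat.strong_induction_on with
    | _ d ih =>
      intro v hv hd
      obtain rfl | ⟨p, hp, hadj, hpd⟩ := hF.parent v hv
      · exact Reachable.refl _
      · refine (ih (G.dist o p) (by omega) p hp rfl).trans (Adj.reachable ?_)
        exact hadj
  exact (connected_iff_exists_forall_reachable _).2 ⟨⟨x, hF.mem⟩, fun v => hreach _ v v.2 rfl⟩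

lemma IsDescFort.isFort [G.LocallyFinite] (hG : G.IsTree) {x : V} {n i : ℕ} {F : Set V}
    (hF : G.IsDescFort o n i (i + 1) x F) : G.IsFort (i + 1) F := by
  refine ⟨⟨x, hF.mem⟩, hF.connected, fun v hv => ?_⟩
  have hfin := (finite_rootedChildren (G := G) o v).subset (Set.sdiff_subset (t := F))
  have hup : ∀ w, G.Adj v w → w ∈ G.rootedChildren o v ∨ v ∈ G.rootedChildren o w :=
    fun w hw => (hG.dist_eq_dist_add_one_of_adj o hw).symm.imp (⟨hw, ·⟩) (⟨hw.symm, ·⟩)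
  by_cases hvx : v = x
  · subst hvx
    have hsub : {w | v ∈ G.rootedChildren o w}.Subsingleton :=
      fun _ hp _ hq => hG.eq_of_mem_rootedChildren hp hq
    have := hsub.finite.to_subtype
    calc {w | G.Adj v w ∧ w ∉ F}.ncard
        ≤ (G.rootedChildren o v \ F ∪ {w | v ∈ G.rootedChildren o w}).ncard :=
          Set.ncard_le_ncard (fun w hw => (hup w hw.1).imp (⟨·, hw.2⟩) id)
            (hfin.union hsub.finite)
      _ ≤ i + 1 := (Set.ncard_union_le _ _).trans
          (add_le_add hF.top (Set.ncard_le_one_iff_subsingleton.2 hsub))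
  · obtain ⟨p, hp, hvp⟩ := (hF.parent v hv).resolve_left hvx
    have hsub : {w | G.Adj v w ∧ w ∉ F} ⊆ G.rootedChildren o v \ F := fun w hw =>
      ⟨(hup w hw.1).resolve_right fun h => hw.2 (hG.eq_of_mem_rootedChildren hvp h ▸ hp), hw.2⟩
    exact (Set.ncard_le_ncard hsub hfin).trans ((hF.other v hv).resolve_left hvx)

end SimpleGraph

/-- Blue Lemma: in a locally finite tree rooted at `o`, if
`|L_R(x)| < (k-1)·k^(R-1)` for some `R ≥ 1`, then `⋃_{0 ≤ r ≤ R} L_r(x)` contains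
a `(k-1)`-fort. -/
theorem blue_lemma (G : SimpleGraph V) [G.LocallyFinite] (hG : G.IsTree)
    (o x : V) (k R : ℕ) (hk : 2 ≤ k) (hR : 1 ≤ R)
    (hsmall : (G.descLevel o x R).ncard < (k - 1) * k ^ (R - 1)) :
    ∃ F : Set V, F ⊆ (⋃ r ∈ Finset.range (R + 1), G.descLevel o x r) ∧
      G.IsFort (k - 1) F := by
  obtain ⟨i, rfl⟩ := Nat.exists_eq_add_of_le' hk
  obtain ⟨n, rfl⟩ := Nat.exists_eq_add_of_le' hR
  obtain ⟨F, hF⟩ := hG.exists_isDescFort_succ (i := i)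
    (fun c => hG.exists_isDescFort (j := i + 1) c) hsmall
  exact ⟨F, hF.subset, hF.isFort hG⟩
end

section
/- Let T be a locally finite rooted tree with root o, k ≥ 2, and suppose |L_R(o)| < k^R for some positive integer R. Then ⋃_{0 ≤ r ≤ R} L_r(o) contains a (k-1)-fort of T. -/
variable {V : Type*}

namespace SimpleGraph

lemma Connected.exists_adj_dist_eq {G : SimpleGraph V} (hG : G.Connected) {o y : V} {n : ℕ}
    (h : G.dist o y = n + 1) : ∃ x, G.Adj x y ∧ G.dist o x = n := by
  obtain ⟨p, hp⟩ := hG.exists_walk_length_eq_dist o y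
  have hnil : ¬ p.Nil := by
    rw [← Walk.length_eq_zero_iff]
    omega
  refine ⟨p.penultimate, p.adj_penultimate hnil, ?_⟩
  have h₁ : G.dist o p.penultimate ≤ n := by
    refine (dist_le p.dropLast).trans ?_
    simp [hp, h]
  have h₂ := (p.adj_penultimate hnil).diff_dist_adj (u := o)
  omega

section RootedTree

variable (G : SimpleGraph V) [G.LocallyFinite] (o : V)

open Classical in
/-- The neighbors of `v` that are one step further away from `o` than `v`. -/
noncomputable def childFinset (v : V) : Finset V :=
  {w ∈ G.neighborFinset v | G.dist o w = G.dist o v + 1}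

open Classical in
/-- The vertices reached from `v` by moving away from `o` exactly `n` times. -/
noncomputable def descendantFinset : ℕ → V → Finset V
  | 0, v => {v}
  | n + 1, v => (G.childFinset o v).biUnion (descendantFinset n)

/-- A vertex is removed in zero steps unconditionally, and in `n + 1` steps if at least `k` of
its children are removed in `n` steps. -/
def IsRemoved (k : ℕ) : ℕ → V → Prop
  | 0, _ => True
  | n + 1, v => k ≤ {w | w ∈ G.childFinset o v ∧ IsRemoved k n w}.ncard

/-- The vertices joined to `o` by a path going away from `o` all of whose vertices `w` are not
removed in `R - G.dist o w` steps. -/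
inductive IsKept (k R : ℕ) : V → Prop
  | root : ¬ G.IsRemoved o k R o → IsKept k R o
  | child {v w : V} : IsKept k R v → w ∈ G.childFinset o v →
      ¬ G.IsRemoved o k (R - G.dist o w) w → IsKept k R w

variable {G o}

lemma mem_childFinset {v w : V} :
    w ∈ G.childFinset o v ↔ G.Adj v w ∧ G.dist o w = G.dist o v + 1 := by
  simp [childFinset]

lemma IsTree.eq_of_mem_childFinset (hG : G.IsTree) {a b c : V} (ha : c ∈ G.childFinset o a)
    (hb : c ∈ G.childFinset o b) : a = b := by
  rw [mem_childFinset] at ha hb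
  obtain ⟨p, hp⟩ := hG.connected.exists_walk_length_eq_dist o a
  obtain ⟨q, hq⟩ := hG.connected.exists_walk_length_eq_dist o b
  have hp' : (p.concat ha.1).IsPath := Walk.isPath_of_length_eq_dist _ (by simp [hp, ha.2])
  have hq' : (q.concat hb.1).IsPath := Walk.isPath_of_length_eq_dist _ (by simp [hq, hb.2])
  have h := congrArg Subtype.val ((hG.isAcyclic.subsingleton_path _ _).elim ⟨_, hp'⟩ ⟨_, hq'⟩)
  exact (Walk.concat_inj h).1

lemma dist_of_mem_descendantFinset {n : ℕ} {v y : V} (h : y ∈ G.descendantFinset o n v) :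
    G.dist o y = G.dist o v + n := by
  induction n generalizing v with
  | zero => simp_all [descendantFinset]
  | succ n ih =>
    simp only [descendantFinset, Finset.mem_biUnion] at h
    obtain ⟨w, hw, hy⟩ := h
    rw [ih hy, (mem_childFinset.1 hw).2]
    omega

lemma IsTree.eq_of_mem_descendantFinset (hG : G.IsTree) {n : ℕ} {v w y : V}
    (hv : y ∈ G.descendantFinset o n v) (hw : y ∈ G.descendantFinset o n w) : v = w := by
  induction n generalizing v w with
  | zero => simp_all [descendantFinset]
  | succ n ih =>
    simp only [descendantFinset, Finset.mem_biUnion] at hv hw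
    obtain ⟨a, ha, hya⟩ := hv
    obtain ⟨b, hb, hyb⟩ := hw
    obtain rfl := ih hya hyb
    exact hG.eq_of_mem_childFinset ha hb

lemma IsTree.pow_le_card_descendantFinset (hG : G.IsTree) {k n : ℕ} {v : V}
    (h : G.IsRemoved o k n v) : k ^ n ≤ (G.descendantFinset o n v).card := by
  classical
  induction n generalizing v with
  | zero => simp [descendantFinset]
  | succ n ih =>
    set s := {w ∈ G.childFinset o v | G.IsRemoved o k n w} with hs
    have hk : k ≤ s.card := by
      rw [← Set.ncard_coe_finset, hs, Finset.coe_filter]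
      exact h
    calc k ^ (n + 1) = k * k ^ n := pow_succ' k n
      _ ≤ s.card * k ^ n := by gcongr
      _ ≤ ∑ w ∈ s, (G.descendantFinset o n w).card :=
        Finset.card_nsmul_le_sum _ _ _ fun w hw ↦ ih (Finset.mem_filter.1 hw).2
      _ = (s.biUnion (G.descendantFinset o n)).card := by
        refine (Finset.card_biUnion fun a _ b _ hab ↦ ?_).symm
        exact Finset.disjoint_left.2 fun y hya hyb ↦
          hab (hG.eq_of_mem_descendantFinset hya hyb)
      _ ≤ (G.descendantFinset o (n + 1) v).card :=
        Finset.card_le_card (Finset.biUnion_subset_biUnion_of_subset_left _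
          (Finset.filter_subset _ _))

lemma Connected.finite_setOf_dist_eq (hG : G.Connected) (n : ℕ) :
    {y | G.dist o y = n}.Finite := by
  induction n with
  | zero => simp [hG.dist_eq_zero_iff]
  | succ n ih =>
    refine (ih.biUnion fun x _ ↦ (G.neighborSet x).toFinite).subset fun y hy ↦ ?_
    obtain ⟨x, hxy, hx⟩ := hG.exists_adj_dist_eq hy
    exact Set.mem_biUnion (show x ∈ {x | G.dist o x = n} from hx) hxy

lemma IsTree.not_isRemoved (hG : G.IsTree) {k R : ℕ}
    (h : {y | G.dist o y = R}.ncard < k ^ R) : ¬ G.IsRemoved o k R o := by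
  intro hr
  refine h.not_ge ((hG.pow_le_card_descendantFinset hr).trans ?_)
  rw [← Set.ncard_coe_finset]
  refine Set.ncard_le_ncard (fun y hy ↦ ?_) (hG.connected.finite_setOf_dist_eq R)
  simpa using dist_of_mem_descendantFinset hy

lemma IsKept.not_isRemoved {k R : ℕ} {v : V} (h : G.IsKept o k R v) :
    ¬ G.IsRemoved o k (R - G.dist o v) v := by
  cases h with
  | root h => simpa using h
  | child _ _ h => exact h

lemma IsKept.dist_lt {k R : ℕ} {v : V} (h : G.IsKept o k R v) : G.dist o v < R := by
  by_contra! hle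
  have := h.not_isRemoved
  rw [Nat.sub_eq_zero_of_le hle] at this
  exact this trivial

lemma connected_induce_isKept {k R : ℕ} (h : ¬ G.IsRemoved o k R o) :
    (G.induce {v | G.IsKept o k R v}).Connected := by
  have key : ∀ v (hv : G.IsKept o k R v),
      (G.induce {v | G.IsKept o k R v}).Reachable ⟨o, .root h⟩ ⟨v, hv⟩ := by
    intro v hv
    induction hv with
    | root _ => exact Reachable.refl _
    | child hv hw hr ih =>
      refine ih.trans (Adj.reachable ?_)
      exact (mem_childFinset.1 hw).1
  exact (connected_iff_exists_forall_reachable _).2 ⟨⟨o, .root h⟩, fun v ↦ key v.1 v.2⟩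

lemma IsTree.ncard_adj_not_isKept_lt (hG : G.IsTree) {k R : ℕ} {v : V}
    (hv : G.IsKept o k R v) : {w | G.Adj v w ∧ ¬ G.IsKept o k R w}.ncard < k := by
  have hr := hv.not_isRemoved
  have hlt := hv.dist_lt
  obtain ⟨n, hn⟩ : ∃ n, R - G.dist o v = n + 1 := ⟨R - G.dist o v - 1, by omega⟩
  rw [hn] at hr
  refine lt_of_le_of_lt (Set.ncard_le_ncard ?_ ?_) (not_le.1 hr)
  · rintro w ⟨hvw, hw⟩
    rcases hG.dist_eq_dist_add_one_of_adj o hvw with hd | hd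
    · have hvc : v ∈ G.childFinset o w := mem_childFinset.2 ⟨hvw.symm, hd⟩
      cases hv with
      | root _ => simp at hd
      | child hu hvu _ => exact absurd (hG.eq_of_mem_childFinset hvu hvc ▸ hu) hw
    · have hwc : w ∈ G.childFinset o v := mem_childFinset.2 ⟨hvw, hd⟩
      refine ⟨hwc, ?_⟩
      by_contra hnr
      refine hw (.child hv hwc ?_)
      rwa [show R - G.dist o w = n by omega]
  · exact (G.childFinset o v).finite_toSet.subset fun w hw ↦ hw.1

end RootedTree

end SimpleGraph

/-- Blue Lemma at the root: in a locally finite tree rooted at `o`, if the number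
of vertices at distance `R` from `o` is less than `k^R` for some `R ≥ 1`, then the
ball of radius `R` around `o` contains a `(k-1)`-fort. -/
theorem blue_lemma_root (G : SimpleGraph V) [G.LocallyFinite] (hG : G.IsTree)
    (o : V) (k R : ℕ) (hk : 2 ≤ k) (hR : 1 ≤ R)
    (hsmall : {y | G.dist o y = R}.ncard < k ^ R) :
    ∃ F : Set V, F ⊆ {y | G.dist o y ≤ R} ∧ G.IsFort (k - 1) F := by
  have ho := hG.not_isRemoved hsmall
  exact ⟨{v | G.IsKept o k R v}, fun v hv ↦ hv.dist_lt.le, ⟨o, .root ho⟩,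
    SimpleGraph.connected_induce_isKept ho,
    fun v hv ↦ Nat.le_sub_one_of_lt (hG.ncard_adj_not_isKept_lt hv)⟩
end

section
/- Let T be a locally finite infinite tree and k ≥ 1. Then every vertex x of T is contained in a k-fort F of T with br(F) ≤ max{br(T) − k, 0}. -/
variable {V : Type*}

/-- The children of `v` in the tree `G` rooted at `o`. -/
def SimpleGraph.children (G : SimpleGraph V) (o v : V) : Set V :=
  {w | G.Adj v w ∧ G.dist o w = G.dist o v + 1}

/-- An admissible flow from the root `o` to infinity with capacities `lam ^ (-|e|)`:
`f v` is the amount flowing through the edge from the parent of `v` to `v`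
(and `f o` is the total amount emitted by the root). -/
def SimpleGraph.IsAdmissibleFlow (G : SimpleGraph V) (o : V) (lam : ℝ) (f : V → ℝ) : Prop :=
  0 < f o ∧ (∀ v, 0 ≤ f v) ∧
    (∀ v, f v = ∑ᶠ w ∈ G.children o v, f w) ∧
    (∀ v, v ≠ o → f v ≤ lam ^ (-(G.dist o v : ℝ)))

/-- The branching number of the tree `G` rooted at `o`: the supremum of `λ ≥ 1`
admitting a positive flow from the root to infinity with capacities `λ ^ (-|e|)`
(`0` if no such `λ` exists, in particular for finite trees). -/
noncomputable def SimpleGraph.branchingNumber (G : SimpleGraph V) (o : V) : ℝ :=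
  sSup {lam : ℝ | 1 ≤ lam ∧ ∃ f, G.IsAdmissibleFlow o lam f}


/-- A locally finite rooted tree, presented by the finite sets of children of its vertices
and the level (distance from the root) of each vertex. -/
structure ChildTree (V : Type*) where
  root : V
  ch : V → Finset V
  level : V → ℕ
  level_root : level root = 0
  level_ch : ∀ {v c}, c ∈ ch v → level c = level v + 1
  parent_unique : ∀ {u v c}, c ∈ ch u → c ∈ ch v → u = v
  exists_parent : ∀ {v}, v ≠ root → ∃ u, v ∈ ch u

namespace ChildTree

variable (T : ChildTree V)

/-- The maximal flow through `r` generations below `v`, for the capacities `lam ^ (-j)` at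
depth `j` below `v` (including capacity `1` at `v` itself). -/
noncomputable def cappedFlow (lam : ℝ) : ℕ → V → ℝ
  | 0, _ => 1
  | r + 1, v => min 1 ((∑ c ∈ T.ch v, cappedFlow lam r c) / lam)

variable {lam : ℝ}

lemma cappedFlow_le_one (r : ℕ) (v : V) : T.cappedFlow lam r v ≤ 1 := by
  cases r with
  | zero => exact le_rfl
  | succ r => exact min_le_left _ _

lemma cappedFlow_nonneg (hlam : 1 ≤ lam) (r : ℕ) (v : V) : 0 ≤ T.cappedFlow lam r v := by
  induction r generalizing v with
  | zero => exact zero_le_one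
  | succ r ih =>
    exact le_min zero_le_one (div_nonneg (Finset.sum_nonneg fun c _ => ih c) (by linarith))

lemma cappedFlow_succ_le (hlam : 1 ≤ lam) (r : ℕ) (v : V) :
    T.cappedFlow lam (r + 1) v ≤ T.cappedFlow lam r v := by
  induction r generalizing v with
  | zero => exact min_le_left _ _
  | succ r ih =>
    refine min_le_min le_rfl ?_
    exact div_le_div_of_nonneg_right (Finset.sum_le_sum fun c _ => ih c) (by linarith)

lemma cappedFlow_antitone (hlam : 1 ≤ lam) (v : V) :
    Antitone fun r => T.cappedFlow lam r v :=
  antitone_nat_of_succ_le fun r => T.cappedFlow_succ_le hlam r v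

lemma cappedFlow_child_le (hlam : 1 ≤ lam) (r : ℕ) {v c : V} (hc : c ∈ T.ch v) :
    T.cappedFlow lam (r - 1) c ≤ lam * T.cappedFlow lam r v := by
  have h1 := T.cappedFlow_le_one (lam := lam) (r - 1) c
  cases r with
  | zero => simp only [cappedFlow]; linarith
  | succ r =>
    have hpos : 0 < lam := by linarith
    simp only [cappedFlow]
    rw [mul_min_of_nonneg _ _ hpos.le, mul_div_cancel₀ _ hpos.ne']
    refine le_min (by linarith) ?_
    exact Finset.single_le_sum (f := fun c => T.cappedFlow lam r c)
      (fun i _ => T.cappedFlow_nonneg hlam r i) hc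

lemma cappedFlow_le_root (hlam : 1 ≤ lam) (N : ℕ) (v : V) :
    T.cappedFlow lam (N - T.level v) v ≤ lam ^ T.level v * T.cappedFlow lam N T.root := by
  induction h : T.level v generalizing v with
  | zero =>
    by_cases hv : v = T.root
    · simp [hv]
    · obtain ⟨u, hu⟩ := T.exists_parent hv
      have := T.level_ch hu
      omega
  | succ n ih =>
    have hv : v ≠ T.root := by rintro rfl; rw [T.level_root] at h; omega
    obtain ⟨u, hu⟩ := T.exists_parent hv
    have hl := T.level_ch hu
    have hn : T.level u = n := by omega
    have := T.cappedFlow_child_le hlam (N - n) hu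
    calc T.cappedFlow lam (N - (n + 1)) v ≤ lam * T.cappedFlow lam (N - n) u := by
          rwa [Nat.sub_sub] at this
      _ ≤ lam * (lam ^ n * T.cappedFlow lam N T.root) := by
          have := ih u hn
          gcongr
      _ = _ := by ring

/-- A positive flow conserved at every vertex, subject to the capacities `lam ^ (-level)`. -/
def HasFlow (lam : ℝ) : Prop :=
  ∃ f : V → ℝ, 0 < f T.root ∧ (∀ v, 0 ≤ f v) ∧ (∀ v, f v = ∑ c ∈ T.ch v, f c) ∧
    ∀ v, lam ^ T.level v * f v ≤ 1

lemma hasFlow_of_potential (hlam : 1 ≤ lam) (M : V → ℝ) (hroot : 0 < M T.root)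
    (hM0 : ∀ v, 0 ≤ M v) (hM1 : ∀ v, M v ≤ 1) (hM : ∀ v, lam * M v ≤ ∑ c ∈ T.ch v, M c) :
    T.HasFlow lam := by
  classical
  have hex : ∀ v, ∃ u, v ≠ T.root → v ∈ T.ch u := fun v => by
    by_cases h : v = T.root
    · exact ⟨v, fun h' => absurd h h'⟩
    · obtain ⟨u, hu⟩ := T.exists_parent h
      exact ⟨u, fun _ => hu⟩
  choose par hpar using hex
  let h : ℕ → V → ℝ := fun n => Nat.rec (fun _ => M T.root)
    (fun _ g v => g (par v) * (M v / ∑ c ∈ T.ch (par v), M c)) n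
  have hne : ∀ {v c}, c ∈ T.ch v → c ≠ T.root := by
    rintro v c hc rfl
    have := T.level_ch hc
    rw [T.level_root] at this
    omega
  have hstep : ∀ {v c}, c ∈ T.ch v →
      h (T.level c) c = h (T.level v) v * (M c / ∑ c ∈ T.ch v, M c) := by
    intro v c hc
    have hp : par c = v := T.parent_unique (hpar c (hne hc)) hc
    rw [T.level_ch hc]
    change h (T.level v) (par c) * (M c / ∑ c ∈ T.ch (par c), M c) = _
    rw [hp]
  have hnonneg : ∀ n v, 0 ≤ h n v := by
    intro n
    induction n with
    | zero => intro v; exact hroot.le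
    | succ n ih =>
      intro v
      exact mul_nonneg (ih _) (div_nonneg (hM0 _) (Finset.sum_nonneg fun c _ => hM0 c))
  have hle : ∀ n v, T.level v = n → lam ^ n * h n v ≤ M v := by
    intro n
    induction n with
    | zero =>
      intro v hv
      have : v = T.root := by
        by_contra hne
        obtain ⟨u, hu⟩ := T.exists_parent hne
        have := T.level_ch hu
        omega
      subst this
      simp [h]
    | succ n ih =>
      intro v hv
      have hvr : v ≠ T.root := by rintro rfl; rw [T.level_root] at hv; omega
      obtain ⟨u, hu⟩ := T.exists_parent hvr
      have hl := T.level_ch hu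
      have hun : T.level u = n := by omega
      have hs := hstep hu
      rw [hv, hun] at hs
      rw [hs]
      have h1 := ih u hun
      have h2 := hM u
      have hS0 : 0 ≤ ∑ c ∈ T.ch u, M c := Finset.sum_nonneg fun c _ => hM0 c
      rcases hS0.eq_or_lt with hS | hS
      · rw [← hS]; simpa using hM0 v
      · have h3 : lam * (lam ^ n * h n u) ≤ ∑ c ∈ T.ch u, M c :=
          (mul_le_mul_of_nonneg_left h1 (by linarith)).trans h2
        calc lam ^ (n + 1) * (h n u * (M v / ∑ c ∈ T.ch u, M c))
            = (lam * (lam ^ n * h n u)) / (∑ c ∈ T.ch u, M c) * M v := by ring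
          _ ≤ 1 * M v := by
            gcongr
            · exact hM0 v
            · exact (div_le_one hS).2 h3
          _ = M v := one_mul _
  refine ⟨fun v => h (T.level v) v, ?_, fun v => hnonneg _ _, fun v => ?_, fun v => ?_⟩
  · simpa [T.level_root, h] using hroot
  · rw [Finset.sum_congr rfl fun c hc => hstep hc, ← Finset.mul_sum, ← Finset.sum_div]
    have hS0 : 0 ≤ ∑ c ∈ T.ch v, M c := Finset.sum_nonneg fun c _ => hM0 c
    rcases hS0.eq_or_lt with hS | hS
    · have h1 := hle _ v rfl
      have h2 := hM v
      have h3 : M v ≤ 0 := by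
        by_contra hcon
        push Not at hcon
        have : 0 < lam * M v := by positivity
        linarith
      have h4 : lam ^ T.level v * h (T.level v) v ≤ 0 := h1.trans h3
      have h5 : (0 : ℝ) < lam ^ T.level v := by positivity
      have h6 : h (T.level v) v = 0 :=
        le_antisymm (nonpos_of_mul_nonpos_right h4 h5) (hnonneg _ _)
      simp [h6]
    · rw [div_self hS.ne', mul_one]
  · exact (hle _ v rfl).trans (hM1 v)

/-- Max-flow min-cut, in the limit form needed here. -/
lemma exists_cappedFlow_lt (hlam : 1 ≤ lam) (hno : ¬ T.HasFlow lam) {δ : ℝ} (hδ : 0 < δ) :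
    ∃ N, T.cappedFlow lam N T.root < δ := by
  by_contra! hcon
  have hpos : 0 < lam := by linarith
  have hbdd : ∀ v, BddBelow (Set.range fun r => T.cappedFlow lam r v) := fun v =>
    ⟨0, by rintro _ ⟨r, rfl⟩; exact T.cappedFlow_nonneg hlam r v⟩
  have hlim : ∀ v, Filter.Tendsto (fun r => T.cappedFlow lam r v) Filter.atTop
      (nhds (⨅ r, T.cappedFlow lam r v)) := fun v =>
    tendsto_atTop_ciInf (T.cappedFlow_antitone hlam v) (hbdd v)
  refine hno (T.hasFlow_of_potential hlam (fun v => ⨅ r, T.cappedFlow lam r v) ?_ ?_ ?_ ?_)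
  · exact hδ.trans_le (le_ciInf hcon)
  · exact fun v => le_ciInf fun r => T.cappedFlow_nonneg hlam r v
  · exact fun v => (ciInf_le (hbdd v) 0).trans (T.cappedFlow_le_one 0 v)
  · intro v
    refine le_of_tendsto_of_tendsto (((hlim v).comp (Filter.tendsto_add_atTop_nat 1)).const_mul lam)
      (tendsto_finsetSum (T.ch v) fun c _ => hlim c) (Filter.Eventually.of_forall fun r => ?_)
    have : T.cappedFlow lam (r + 1) v ≤ (∑ c ∈ T.ch v, T.cappedFlow lam r c) / lam :=
      min_le_right _ _
    rw [le_div_iff₀ hpos] at this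
    simpa [mul_comm] using this

/-- `Below P v` says that some strict ancestor of `v` satisfies `P`. -/
inductive Below (P : V → Prop) : V → Prop
  | of_parent {u v} : v ∈ T.ch u → P u → Below P v
  | step {u v} : v ∈ T.ch u → Below P u → Below P v

lemma below_child_iff {P : V → Prop} {u v : V} (h : v ∈ T.ch u) :
    T.Below P v ↔ P u ∨ T.Below P u := by
  constructor
  · rintro (⟨h', hP⟩ | ⟨h', hP⟩)
    · exact Or.inl (T.parent_unique h' h ▸ hP)
    · exact Or.inr (T.parent_unique h' h ▸ hP)
  · rintro (hP | hP)
    · exact .of_parent h hP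
    · exact .step h hP

/-- If there is no flow for `lam`, then there is a cutset beyond level `n` whose cut sums `w`
are arbitrarily small; `D` is the set of vertices strictly beyond the cutset. -/
lemma exists_cut (hlam : 1 ≤ lam) (hno : ¬ T.HasFlow lam) (n : ℕ) {δ : ℝ} (hδ : 0 < δ) :
    ∃ (w : V → ℝ) (D : V → Prop) (N : ℕ), (∀ v, 0 ≤ w v) ∧
      (∀ v, ∑ c ∈ T.ch v, w c ≤ lam * w v) ∧ (∀ v, w v ≤ lam ^ T.level v * δ) ∧
      (∀ v, N < T.level v → w v = 0) ∧ (∀ v, T.level v ≤ n → ¬ D v) ∧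
      ∀ v, ¬ D v → 1 ≤ w v ∨ T.level v < N ∧ ∀ c ∈ T.ch v, ¬ D c := by
  classical
  have hpos : 0 < lam := by linarith
  obtain ⟨N, hN⟩ := T.exists_cappedFlow_lt hlam hno
    (show 0 < min δ ((lam ^ n)⁻¹) from lt_min hδ (by positivity))
  have hN1 := (hN.trans_le (min_le_left _ _)).le
  have hN2 := hN.trans_le (min_le_right _ _)
  let P : V → Prop := fun v => 1 ≤ T.cappedFlow lam (N - T.level v) v
  have hPlevel : ∀ v, P v → n < T.level v := by
    intro v hv
    by_contra! hle
    have h1 : 1 ≤ lam ^ T.level v * T.cappedFlow lam N T.root :=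
      le_trans hv (T.cappedFlow_le_root hlam N v)
    have h2 : lam ^ T.level v * T.cappedFlow lam N T.root
        ≤ lam ^ n * T.cappedFlow lam N T.root :=
      mul_le_mul_of_nonneg_right (pow_le_pow_right₀ hlam hle) (T.cappedFlow_nonneg hlam _ _)
    have h3 : lam ^ n * T.cappedFlow lam N T.root < lam ^ n * (lam ^ n)⁻¹ := by gcongr
    rw [mul_inv_cancel₀ (by positivity)] at h3
    linarith
  have hDlevel : ∀ v, T.Below P v → n < T.level v := by
    intro v hv
    induction hv with
    | of_parent h hP => have := hPlevel _ hP; have := T.level_ch h; omega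
    | step h _ ih => have := T.level_ch h; omega
  have hPN : ∀ v, N ≤ T.level v → P v := by
    intro v hv
    simp [P, Nat.sub_eq_zero_of_le hv, cappedFlow]
  refine ⟨fun v => if T.Below P v then 0 else T.cappedFlow lam (N - T.level v) v, T.Below P, N,
    fun v => ?_, fun v => ?_, fun v => ?_, fun v hv => ?_, fun v hv hD => ?_, fun v hv => ?_⟩
  · dsimp only
    split_ifs
    exacts [le_rfl, T.cappedFlow_nonneg hlam _ _]
  · dsimp only
    by_cases hD : P v ∨ T.Below P v
    · rw [Finset.sum_eq_zero fun c hc => if_pos ((T.below_child_iff hc).2 hD)]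
      split_ifs
      exacts [by simp, mul_nonneg hpos.le (T.cappedFlow_nonneg hlam _ _)]
    · have hv : T.level v < N := by
        by_contra! h
        exact hD (Or.inl (hPN v h))
      rw [if_neg fun h => hD (Or.inr h)]
      have hP : ¬ P v := fun h => hD (Or.inl h)
      obtain ⟨r, hr⟩ : ∃ r, N - T.level v = r + 1 := ⟨N - T.level v - 1, by omega⟩
      have hsum : ∑ c ∈ T.ch v, (if T.Below P c then 0 else T.cappedFlow lam (N - T.level c) c)
          = ∑ c ∈ T.ch v, T.cappedFlow lam r c := by
        refine Finset.sum_congr rfl fun c hc => ?_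
        rw [if_neg (mt (T.below_child_iff hc).1 hD), T.level_ch hc]
        congr 1
        omega
      rw [hsum]
      have hP' : T.cappedFlow lam (r + 1) v < 1 := by
        simpa [P, hr] using hP
      rw [hr]
      simp only [cappedFlow] at hP' ⊢
      rw [min_eq_right ((min_lt_iff.1 hP').resolve_left (lt_irrefl _)).le,
        mul_div_cancel₀ _ hpos.ne']
  · dsimp only
    split_ifs
    · positivity
    · exact (T.cappedFlow_le_root hlam N v).trans
        (mul_le_mul_of_nonneg_left hN1 (by positivity))
  · have hvr : v ≠ T.root := by rintro rfl; rw [T.level_root] at hv; omega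
    obtain ⟨u, hu⟩ := T.exists_parent hvr
    have := T.level_ch hu
    exact if_pos (.of_parent hu (hPN u (by omega)))
  · have := hDlevel v hD
    omega
  · dsimp only
    rw [if_neg hv]
    by_cases hP : P v
    · exact Or.inl hP
    · refine Or.inr ⟨?_, fun c hc => ?_⟩
      · by_contra! h
        exact hP (hPN v h)
      · rw [T.below_child_iff hc]
        exact not_or.2 ⟨hP, hv⟩

end ChildTree

/-- Any finite set contains a subset of its `k` largest elements (or is itself of size at
most `k`). -/
lemma Finset.exists_top_subset {α : Type*} [DecidableEq α] (W : α → ℝ) (k : ℕ) (s : Finset α) :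
    ∃ K ⊆ s, K.card ≤ k ∧ (∀ a ∈ K, ∀ b ∈ s \ K, W b ≤ W a) ∧ (K.card = k ∨ K = s) := by
  induction k with
  | zero => exact ⟨∅, by simp⟩
  | succ k ih =>
    obtain ⟨K, hKs, hKk, hKtop, hK⟩ := ih
    by_cases hs : K = s
    · exact ⟨K, hKs, by omega, hKtop, Or.inr hs⟩
    have hne : (s \ K).Nonempty := by
      rw [Finset.sdiff_nonempty]
      exact fun h => hs (hKs.antisymm h)
    obtain ⟨a, ha, hmax⟩ := Finset.exists_max_image (s \ K) W hne
    rw [Finset.mem_sdiff] at ha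
    have hcard := hK.resolve_right hs
    refine ⟨insert a K, Finset.insert_subset ha.1 hKs, ?_, ?_, ?_⟩
    · rw [Finset.card_insert_of_notMem ha.2]; omega
    · intro b hb c hc
      have hc' : c ∈ s \ K := by
        simp only [Finset.mem_sdiff, Finset.mem_insert, not_or] at hc ⊢
        exact ⟨hc.1, hc.2.2⟩
      rcases Finset.mem_insert.1 hb with rfl | hb
      · exact hmax c hc'
      · exact hKtop b hb c hc'
    · left
      rw [Finset.card_insert_of_notMem ha.2, hcard]

/-- Removing the `k` largest summands turns superharmonicity of `W` for `mu + k` into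
superharmonicity of `W ^ ((mu + k) / mu)` for `mu`. -/
lemma Finset.sum_rpow_sdiff_top_le {α : Type*} [DecidableEq α] (W : α → ℝ) {k : ℕ}
    {s K : Finset α} (hW : ∀ a, 0 ≤ W a) (hKs : K ⊆ s)
    (htop : ∀ a ∈ K, ∀ b ∈ s \ K, W b ≤ W a) (hK : K.card = k ∨ K = s) {mu y : ℝ}
    (hmu : 0 < mu) (hy0 : 0 ≤ y) (hy : ∑ a ∈ s, W a ≤ (mu + k) * y) :
    ∑ a ∈ s \ K, W a ^ ((mu + k) / mu) ≤ mu * y ^ ((mu + k) / mu) := by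
  rcases (s \ K).eq_empty_or_nonempty with hR | hR
  · rw [hR, Finset.sum_empty]; positivity
  have hcard : K.card = k := hK.resolve_right fun h => by simp [h] at hR
  obtain ⟨b, hb, hmax⟩ := Finset.exists_max_image (s \ K) W hR
  have hk0 : (0 : ℝ) ≤ k := Nat.cast_nonneg k
  set m := W b with hm
  have hm0 : 0 ≤ m := hW b
  set S := ∑ a ∈ s \ K, W a with hS
  have hS0 : 0 ≤ S := Finset.sum_nonneg fun a _ => hW a
  have hp : (mu + k) / mu = k / mu + 1 := by field_simp; ring
  have h1 : ∑ a ∈ s \ K, W a ^ ((mu + k) / mu) ≤ m ^ ((k : ℝ) / mu) * S := by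
    rw [hS, Finset.mul_sum]
    refine Finset.sum_le_sum fun a ha => ?_
    rw [hp, Real.rpow_add_one' (hW a) (by positivity)]
    exact mul_le_mul_of_nonneg_right (Real.rpow_le_rpow (hW a) (hmax a ha) (by positivity)) (hW a)
  have h2 : k * m + S ≤ (mu + k) * y := by
    refine le_trans ?_ hy
    rw [← Finset.sum_sdiff hKs, add_comm]
    gcongr
    rw [← hcard, ← nsmul_eq_mul]
    exact Finset.card_nsmul_le_sum _ _ _ fun a ha => htop a ha b hb
  have h3 := Real.geom_mean_le_arith_mean2_weighted (w₁ := k / (mu + k)) (w₂ := mu / (mu + k))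
    (p₁ := m) (p₂ := S / mu) (by positivity) (by positivity) hm0 (by positivity)
    (by field_simp; ring)
  have h4 : k / (mu + k) * m + mu / (mu + k) * (S / mu) ≤ y := by
    have : k / (mu + k) * m + mu / (mu + k) * (S / mu) = (k * m + S) / (mu + k) := by
      field_simp
    rw [this, div_le_iff₀ (by positivity)]
    linarith
  have h5 := Real.rpow_le_rpow (by positivity) (h3.trans h4)
    (show 0 ≤ (mu + k) / mu by positivity)
  rw [Real.mul_rpow (by positivity) (by positivity), ← Real.rpow_mul hm0,
    ← Real.rpow_mul (by positivity)] at h5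
  have e1 : (k : ℝ) / (mu + k) * ((mu + k) / mu) = k / mu := by field_simp
  have e2 : mu / (mu + k) * ((mu + k) / mu) = 1 := by field_simp
  rw [e1, e2, Real.rpow_one] at h5
  calc _ ≤ m ^ ((k : ℝ) / mu) * S := h1
    _ = mu * (m ^ ((k : ℝ) / mu) * (S / mu)) := by field_simp
    _ ≤ _ := by gcongr

namespace ChildTree

variable (T : ChildTree V)

/-- If no `lam > b` admits a flow, one can prune at most `k` children at each vertex so that
no `mu > b - k` admits a flow in the pruned tree. -/
lemma exists_pruning [DecidableEq V] (b : ℝ) (hb : ∀ lam, 1 ≤ lam → b < lam → ¬ T.HasFlow lam)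
    (k : ℕ) (hk : 1 ≤ k) : ∃ K : V → Finset V, (∀ v, K v ⊆ T.ch v ∧ (K v).card ≤ k) ∧
      ∀ mu : ℝ, 1 ≤ mu → b < mu + k → ∀ f : V → ℝ, (∀ v, 0 ≤ f v) →
        (∀ v, f v ≤ ∑ c ∈ T.ch v \ K v, f c) →
        (∀ v, v ≠ T.root → mu ^ T.level v * f v ≤ 1) → f T.root ≤ 0 := by
  set L : ℝ := max b 1 + 1 with hL
  have hL1 : 1 ≤ L := by have := le_max_right b 1; linarith
  let l : ℕ → ℝ := fun n => max b 1 + 1 / (n + 1)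
  have hl0 : ∀ n : ℕ, (0 : ℝ) < 1 / (n + 1) := fun n => by positivity
  have hl1 : ∀ n, 1 ≤ l n := fun n => by
    have := le_max_right b 1; have := hl0 n; simp only [l]; linarith
  have hlb : ∀ n, b < l n := fun n => by
    have := le_max_left b 1; have := hl0 n; simp only [l]; linarith
  have hlL : ∀ n, l n ≤ L := fun n => by
    have : (1 : ℝ) / (n + 1) ≤ 1 := by
      rw [div_le_one (by positivity)]; have : (0 : ℝ) ≤ n := n.cast_nonneg; linarith
    simp only [l, hL]; linarith
  choose w D N hw0 hwsum hwle hwzero hDlevel hwcut using fun n : ℕ =>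
    T.exists_cut (hl1 n) (hb _ (hl1 n) (hlb n)) n (δ := ((4 : ℝ) ^ n)⁻¹) (by positivity)
  have hterm0 : ∀ v n, 0 ≤ (2 : ℝ) ^ n * w n v := fun v n => mul_nonneg (by positivity) (hw0 n v)
  have hsummable : ∀ v, Summable fun n => (2 : ℝ) ^ n * w n v := fun v => by
    refine Summable.of_nonneg_of_le (hterm0 v) (fun n => ?_)
      ((summable_geometric_of_lt_one (r := (1 / 2 : ℝ)) (by norm_num) (by norm_num)).mul_left
        (L ^ T.level v))
    have h1 : w n v ≤ L ^ T.level v * ((4 : ℝ) ^ n)⁻¹ := (hwle n v).trans <| by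
      have := hlL n
      have := hl1 n
      gcongr
    calc (2 : ℝ) ^ n * w n v ≤ 2 ^ n * (L ^ T.level v * ((4 : ℝ) ^ n)⁻¹) := by gcongr
      _ = L ^ T.level v * (1 / 2) ^ n := by
        rw [show (4 : ℝ) = 2 * 2 by norm_num, mul_pow, div_pow, one_pow]
        field_simp
  let W : V → ℝ := fun v => ∑' n, (2 : ℝ) ^ n * w n v
  have hW0 : ∀ v, 0 ≤ W v := fun v => tsum_nonneg (hterm0 v)
  choose K hKs hKk hKtop hK using fun v => Finset.exists_top_subset W k (T.ch v)
  refine ⟨K, fun v => ⟨hKs v, hKk v⟩, fun mu hmu hmub f hf0 hfsum hfcap => ?_⟩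
  have hmupos : 0 < mu := by linarith
  have hk1 : (1 : ℝ) ≤ k := by exact_mod_cast hk
  obtain ⟨n₀, hn₀⟩ : ∃ n₀, ∀ n, n₀ ≤ n → l n ≤ mu + k := by
    have hgap : 0 < mu + k - max b 1 := by
      have : max b 1 < mu + k := max_lt hmub (by linarith)
      linarith
    obtain ⟨n₀, hn₀⟩ := exists_nat_one_div_lt hgap
    refine ⟨n₀, fun n hn => ?_⟩
    have : (1 : ℝ) / (n + 1) ≤ 1 / (n₀ + 1) := by gcongr
    simp only [l]; linarith
  obtain ⟨N₀, hN₀⟩ : ∃ N₀, ∀ n < n₀, N n ≤ N₀ :=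
    ⟨(Finset.range n₀).sup N, fun n hn => Finset.le_sup (Finset.mem_range.2 hn)⟩
  have hWsum : ∀ v, N₀ < T.level v → ∑ c ∈ T.ch v, W c ≤ (mu + k) * W v := by
    intro v hv
    simp only [W]
    rw [← Summable.tsum_finsetSum fun c _ => hsummable c, ← tsum_mul_left]
    refine Summable.tsum_le_tsum (fun n => ?_) (summable_sum fun c _ => hsummable c)
      ((hsummable v).mul_left _)
    rw [← Finset.mul_sum]
    by_cases hn : n < n₀
    · have := hN₀ n hn
      rw [Finset.sum_eq_zero fun c hc => hwzero n c (by have := T.level_ch hc; omega)]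
      have := hterm0 v n
      rw [mul_zero]
      positivity
    · calc (2 : ℝ) ^ n * ∑ c ∈ T.ch v, w n c ≤ 2 ^ n * (l n * w n v) := by
            have := hwsum n v
            gcongr
        _ ≤ 2 ^ n * ((mu + k) * w n v) := by
            have := hn₀ n (not_lt.1 hn)
            have := hw0 n v
            gcongr
        _ = _ := by ring
  set p : ℝ := (mu + k) / mu with hp
  have hp1 : 1 ≤ p := by rw [hp, one_le_div hmupos]; linarith
  have hWp : ∀ v, N₀ < T.level v → ∑ c ∈ T.ch v \ K v, W c ^ p ≤ mu * W v ^ p := fun v hv =>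
    Finset.sum_rpow_sdiff_top_le W hW0 (hKs v) (hKtop v) (hK v) hmupos (hW0 v) (hWsum v hv)
  have hbound : ∀ n d v, N n ≤ T.level v + d → N₀ < T.level v → ¬ D n v →
      (2 : ℝ) ^ n * (mu ^ T.level v * f v) ≤ W v ^ p := by
    intro n d
    have hcut : ∀ v, N₀ < T.level v → 1 ≤ w n v →
        (2 : ℝ) ^ n * (mu ^ T.level v * f v) ≤ W v ^ p := by
      intro v hvl hwv
      have hv : v ≠ T.root := by rintro rfl; rw [T.level_root] at hvl; omega
      have h1 : (2 : ℝ) ^ n ≤ W v := by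
        have h2 := (hsummable v).le_tsum n fun i _ => hterm0 v i
        have h3 : (2 : ℝ) ^ n * 1 ≤ 2 ^ n * w n v := by gcongr
        simp only [W]; linarith
      calc (2 : ℝ) ^ n * (mu ^ T.level v * f v) ≤ 2 ^ n * 1 := by
            have := hfcap v hv
            gcongr
        _ ≤ W v := by rwa [mul_one]
        _ ≤ W v ^ p := Real.self_le_rpow_of_one_le
            ((one_le_pow₀ (by norm_num)).trans h1) hp1
    induction d with
    | zero =>
      intro v hv hvl hD
      exact hcut v hvl ((hwcut n v hD).resolve_right fun h => by omega)
    | succ d ih =>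
      intro v hv hvl hD
      rcases hwcut n v hD with h | ⟨-, hch⟩
      · exact hcut v hvl h
      · refine le_of_mul_le_mul_left (le_trans ?_ (hWp v hvl)) hmupos
        calc mu * ((2 : ℝ) ^ n * (mu ^ T.level v * f v))
            ≤ mu * ((2 : ℝ) ^ n * (mu ^ T.level v * ∑ c ∈ T.ch v \ K v, f c)) := by
              have := hfsum v
              gcongr
          _ = ∑ c ∈ T.ch v \ K v, (2 : ℝ) ^ n * (mu ^ (T.level v + 1) * f c) := by
              rw [← Finset.mul_sum, ← Finset.mul_sum]
              ring
          _ ≤ _ := Finset.sum_le_sum fun c hc => by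
              have hc := (Finset.mem_sdiff.1 hc).1
              have hl := T.level_ch hc
              rw [← hl]
              exact ih c (by omega) (by omega) (hch c hc)
  have hlevel : ∀ d v, T.level v + d = N₀ + 1 → f v ≤ 0 := by
    intro d
    induction d with
    | zero =>
      intro v hv
      by_contra! hfv
      have hpos : 0 < mu ^ T.level v * f v := by positivity
      obtain ⟨n, hn⟩ := pow_unbounded_of_one_lt (W v ^ p / (mu ^ T.level v * f v))
        (one_lt_two (α := ℝ))
      have hmax : (2 : ℝ) ^ n ≤ 2 ^ max n (N₀ + 1) :=
        pow_le_pow_right₀ one_le_two (le_max_left _ _)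
      have := hbound (max n (N₀ + 1)) _ v (Nat.le_add_left _ _) (by omega)
        (hDlevel _ v (by omega))
      rw [← le_div_iff₀ hpos] at this
      linarith
    | succ d ih =>
      intro v hv
      refine (hfsum v).trans (Finset.sum_nonpos fun c hc => ih c ?_)
      have := T.level_ch (Finset.mem_sdiff.1 hc).1
      omega
  exact hlevel (N₀ + 1) _ (by rw [T.level_root, zero_add])

end ChildTree

namespace SimpleGraph

variable {G : SimpleGraph V}

lemma IsTree.eq_of_mem_children (hG : G.IsTree) {x u v c : V} (hu : c ∈ G.children x u)
    (hv : c ∈ G.children x v) : u = v := by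
  have key : ∀ w, c ∈ G.children x w →
      ∃ p : G.Walk x c, p.IsPath ∧ p.penultimate = w := by
    rintro w ⟨hadj, hdist⟩
    obtain ⟨p, hp⟩ := hG.connected.exists_walk_length_eq_dist x w
    refine ⟨p.concat hadj, Walk.isPath_of_length_eq_dist _ ?_, Walk.penultimate_concat _ _⟩
    rw [Walk.length_concat, hp, hdist]
  obtain ⟨p, hp, hpu⟩ := key u hu
  obtain ⟨q, hq, hqv⟩ := key v hv
  rw [← hpu, ← hqv, (hG.existsUnique_path x c).unique hp hq]

lemma Connected.exists_mem_children (hG : G.Connected) {x v : V} (hv : v ≠ x) :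
    ∃ u, v ∈ G.children x u := by
  obtain ⟨p, hp⟩ := hG.exists_walk_length_eq_dist x v
  have hnil : ¬ p.Nil := Walk.not_nil_of_ne hv.symm
  have hadj := p.adj_penultimate hnil
  refine ⟨p.penultimate, hadj, ?_⟩
  have h1 : G.dist x p.penultimate ≤ p.length - 1 := by
    simpa using dist_le p.dropLast
  have h2 : G.dist x v ≤ G.dist x p.penultimate + 1 := by
    have := hG.dist_triangle (u := x) (v := p.penultimate) (w := v)
    rwa [dist_eq_one_iff_adj.2 hadj] at this
  have h3 : 0 < p.length := by
    rw [hp]; exact hG.pos_dist_of_ne hv.symm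
  omega

lemma finite_children [G.LocallyFinite] (x v : V) : (G.children x v).Finite :=
  (G.neighborSet v).toFinite.subset fun _ hw => hw.1

/-- The rooted tree structure of a tree with a chosen root. -/
noncomputable def IsTree.toChildTree [G.LocallyFinite] (hG : G.IsTree) (x : V) :
    ChildTree V where
  root := x
  ch v := (G.finite_children x v).toFinset
  level := G.dist x
  level_root := dist_self
  level_ch h := ((Set.Finite.mem_toFinset _).1 h).2
  parent_unique hu hv :=
    hG.eq_of_mem_children ((Set.Finite.mem_toFinset _).1 hu) ((Set.Finite.mem_toFinset _).1 hv)
  exists_parent hv := by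
    simpa only [Set.Finite.mem_toFinset] using hG.connected.exists_mem_children hv

lemma IsTree.mem_ch_toChildTree [G.LocallyFinite] (hG : G.IsTree) {x v c : V} :
    c ∈ (hG.toChildTree x).ch v ↔ c ∈ G.children x v :=
  Set.Finite.mem_toFinset _

lemma IsTree.finsum_children [G.LocallyFinite] (hG : G.IsTree) (x v : V) (f : V → ℝ) :
    ∑ᶠ c ∈ G.children x v, f c = ∑ c ∈ (hG.toChildTree x).ch v, f c :=
  finsum_mem_eq_finite_toFinset_sum _ _

lemma IsTree.exists_isAdmissibleFlow [G.LocallyFinite] (hG : G.IsTree) {x : V} {lam : ℝ}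
    (hlam : 1 ≤ lam) (h : (hG.toChildTree x).HasFlow lam) :
    ∃ f, G.IsAdmissibleFlow x lam f := by
  obtain ⟨f, hroot, hnonneg, hsum, hcap⟩ := h
  refine ⟨f, hroot, hnonneg, fun v => (hsum v).trans (hG.finsum_children x v f).symm,
    fun v _ => ?_⟩
  rw [Real.rpow_neg (by linarith), Real.rpow_natCast, ← one_div, le_div_iff₀ (by positivity),
    mul_comm]
  exact hcap v

variable {x : V} {F : Set V}

/-- If `F` contains the parent of each of its vertices other than `x`, then each vertex of `F`
is joined to `x` by a geodesic inside `F`. -/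
lemma exists_walk_induce (hG : G.Connected) (hx : x ∈ F)
    (hF : ∀ v ∈ F, v ≠ x → ∃ u ∈ F, v ∈ G.children x u) (v : F) :
    ∃ p : (G.induce F).Walk ⟨x, hx⟩ v, p.length = G.dist x v := by
  induction h : G.dist x v generalizing v with
  | zero =>
    have : v = ⟨x, hx⟩ := Subtype.ext (hG.dist_eq_zero_iff.1 h).symm
    subst this
    exact ⟨.nil, rfl⟩
  | succ n ih =>
    have hv : (v : V) ≠ x := by
      intro hv
      rw [hv, dist_self] at h
      omega
    obtain ⟨u, huF, hadj, hdist⟩ := hF v v.2 hv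
    obtain ⟨p, hp⟩ := ih ⟨u, huF⟩ (by simp only; omega)
    exact ⟨p.concat (show (G.induce F).Adj ⟨u, huF⟩ v from hadj), by rw [Walk.length_concat, hp]⟩

lemma connected_induce_of_parent_mem (hG : G.Connected) (hx : x ∈ F)
    (hF : ∀ v ∈ F, v ≠ x → ∃ u ∈ F, v ∈ G.children x u) : (G.induce F).Connected := by
  rw [connected_iff_exists_forall_reachable]
  exact ⟨⟨x, hx⟩, fun v => ⟨(exists_walk_induce hG hx hF v).choose⟩⟩

lemma dist_induce_of_parent_mem (hG : G.Connected) (hx : x ∈ F)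
    (hF : ∀ v ∈ F, v ≠ x → ∃ u ∈ F, v ∈ G.children x u) (v : F) :
    (G.induce F).dist ⟨x, hx⟩ v = G.dist x v := by
  obtain ⟨p, hp⟩ := exists_walk_induce hG hx hF v
  refine le_antisymm (hp ▸ dist_le p) ?_
  obtain ⟨q, hq⟩ :=
    (connected_induce_of_parent_mem hG hx hF).exists_walk_length_eq_dist ⟨x, hx⟩ v
  rw [← hq, ← Walk.length_map (Embedding.induce F).toHom q]
  exact dist_le _

lemma finsum_children_induce (hG : G.Connected) (hx : x ∈ F)
    (hF : ∀ v ∈ F, v ≠ x → ∃ u ∈ F, v ∈ G.children x u) (v : F) (f : F → ℝ) (g : V → ℝ)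
    (hfg : ∀ w : F, f w = g w) :
    ∑ᶠ w ∈ (G.induce F).children ⟨x, hx⟩ v, f w = ∑ᶠ w ∈ G.children x v ∩ F, g w := by
  have hd := dist_induce_of_parent_mem hG hx hF
  refine finsum_mem_eq_of_bijOn Subtype.val
    ⟨?_, Subtype.val_injective.injOn, ?_⟩ fun w _ => hfg w
  · rintro w ⟨hadj, hdist⟩
    rw [hd, hd] at hdist
    exact ⟨⟨hadj, hdist⟩, w.2⟩
  · rintro w ⟨⟨hadj, hdist⟩, hw⟩
    refine ⟨⟨w, hw⟩, ⟨hadj, ?_⟩, rfl⟩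
    rw [hd, hd]
    exact hdist

lemma exists_isAdmissibleFlow_induce_univ (hG : G.Connected) {lam : ℝ}
    (h : ∃ f, G.IsAdmissibleFlow x lam f) :
    ∃ f, (G.induce Set.univ).IsAdmissibleFlow ⟨x, Set.mem_univ x⟩ lam f := by
  have hF : ∀ v ∈ (Set.univ : Set V), v ≠ x → ∃ u ∈ Set.univ, v ∈ G.children x u := by
    intro v _ hv
    simpa using hG.exists_mem_children hv
  obtain ⟨f, hroot, hnonneg, hsum, hcap⟩ := h
  refine ⟨fun v => f v, hroot, fun v => hnonneg v, fun v => ?_, fun v hv => ?_⟩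
  · rw [finsum_children_induce hG _ hF v _ f fun _ => rfl, Set.inter_univ]
    exact hsum v
  · rw [dist_induce_of_parent_mem hG _ hF]
    exact hcap v fun h => hv (Subtype.ext h)

/-- The vertices left when the children in `K v` are deleted, with all their descendants, for
every vertex `v`. -/
inductive Unpruned (G : SimpleGraph V) (x : V) (K : V → Finset V) : V → Prop
  | root : Unpruned G x K x
  | child {v c} : Unpruned G x K v → c ∈ G.children x v → c ∉ K v → Unpruned G x K c

variable {K : V → Finset V}

lemma Unpruned.exists_parent {v : V} (h : G.Unpruned x K v) (hv : v ≠ x) :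
    ∃ u, G.Unpruned x K u ∧ v ∈ G.children x u ∧ v ∉ K u := by
  cases h with
  | root => exact absurd rfl hv
  | child hu hc hK => exact ⟨_, hu, hc, hK⟩

lemma IsTree.not_unpruned_of_mem (hG : G.IsTree) {v c : V} (hc : c ∈ G.children x v)
    (hcK : c ∈ K v) : ¬ G.Unpruned x K c := by
  intro h
  have hcx : c ≠ x := by
    rintro rfl
    have := hc.2
    rw [dist_self] at this
    omega
  obtain ⟨u, -, hu, huK⟩ := h.exists_parent hcx
  rw [hG.eq_of_mem_children hu hc] at huK
  exact huK hcK

lemma IsTree.isFort_unpruned (hG : G.IsTree) {k : ℕ} (hK : ∀ v, (K v).card ≤ k) :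
    G.IsFort k {v | G.Unpruned x K v} := by
  refine ⟨⟨x, .root⟩, connected_induce_of_parent_mem hG.connected (x := x) .root ?_, ?_⟩
  · intro v hv hvx
    obtain ⟨u, hu, hc, -⟩ := Unpruned.exists_parent hv hvx
    exact ⟨u, hu, hc⟩
  · intro v hv
    refine le_trans ?_ (hK v)
    rw [← Set.ncard_coe_finset]
    refine Set.ncard_le_ncard ?_ (K v).finite_toSet
    rintro w ⟨hadj, hw⟩
    rcases hG.dist_eq_dist_add_one_of_adj x hadj with h | h
    · exfalso
      have hvw : v ∈ G.children x w := ⟨hadj.symm, h⟩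
      have hvx : v ≠ x := by
        rintro rfl
        rw [dist_self] at h
        omega
      obtain ⟨u, hu, hc, -⟩ := Unpruned.exists_parent hv hvx
      exact hw (hG.eq_of_mem_children hc hvw ▸ hu)
    · by_contra hwK
      exact hw (.child hv ⟨hadj, h⟩ hwK)

end SimpleGraph

/-- Pruning theorem: in a locally finite infinite tree `T`, every vertex `x` is
contained in a `k`-fort `F` with `br(F) ≤ max (br(T) - k) 0`. -/
theorem pruning_theorem (G : SimpleGraph V) [G.LocallyFinite]
    (hG : G.IsTree) (hinf : Set.Infinite (Set.univ : Set V)) (k : ℕ) (hk : 1 ≤ k) :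
    ∀ x : V, ∃ (F : Set V) (hx : x ∈ F), G.IsFort k F ∧
      (G.induce F).branchingNumber ⟨x, hx⟩
        ≤ max (G.branchingNumber x - k) 0 := by
  classical
  intro x
  by_cases hbdd : BddAbove {lam : ℝ | 1 ≤ lam ∧ ∃ f, G.IsAdmissibleFlow x lam f}
  · obtain ⟨K, hK, hflow⟩ := (hG.toChildTree x).exists_pruning (G.branchingNumber x)
      (fun lam h1 hlt h => hlt.not_ge
        (le_csSup hbdd ⟨h1, hG.exists_isAdmissibleFlow h1 h⟩)) k hk
    set F : Set V := {v | G.Unpruned x K v} with hFdef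
    have hx : x ∈ F := .root
    have hF : ∀ v ∈ F, v ≠ x → ∃ u ∈ F, v ∈ G.children x u := by
      intro v hv hvx
      obtain ⟨u, hu, hc, -⟩ := SimpleGraph.Unpruned.exists_parent hv hvx
      exact ⟨u, hu, hc⟩
    refine ⟨F, hx, hG.isFort_unpruned fun v => (hK v).2, Real.sSup_le ?_ (le_max_right _ _)⟩
    rintro mu ⟨hmu, f, hroot, hnonneg, hsum, hcap⟩
    by_contra! hlt
    have hmuk : G.branchingNumber x < mu + k := by
      have := (le_max_left _ _).trans_lt hlt
      linarith
    let g : V → ℝ := fun v => if h : v ∈ F then f ⟨v, h⟩ else 0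
    have hg : ∀ v : F, f v = g v := fun v => by simp [g]
    have hg0 : ∀ v, 0 ≤ g v := fun v => by
      simp only [g]
      split_ifs
      exacts [hnonneg _, le_rfl]
    have hgF : ∀ v, v ∉ F → g v = 0 := fun v hv => dif_neg hv
    refine (hflow mu hmu hmuk g hg0 (fun v => ?_) fun v hv => ?_).not_gt
      (show 0 < g x from hg ⟨x, hx⟩ ▸ hroot)
    · by_cases hv : v ∈ F
      · rw [← hg ⟨v, hv⟩, hsum, SimpleGraph.finsum_children_induce hG.connected hx hF _ f g hg]
        refine (finsum_mem_eq_sum_of_inter_support_eq _ ?_).le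
        ext c
        simp only [Set.mem_inter_iff, Function.mem_support, Finset.coe_sdiff, Set.mem_sdiff,
          Finset.mem_coe, hG.mem_ch_toChildTree]
        refine and_congr_left fun hgc => ?_
        have hcF : c ∈ F := not_imp_comm.1 (hgF c) hgc
        exact and_congr_right fun hc => iff_of_true hcF fun hcK => hG.not_unpruned_of_mem hc hcK hcF
      · rw [hgF v hv]
        exact Finset.sum_nonneg fun c _ => hg0 c
    · change mu ^ G.dist x v * g v ≤ 1
      have hpos : 0 < mu := by linarith
      by_cases hvF : v ∈ F
      · have := hcap ⟨v, hvF⟩ fun h => hv (congrArg Subtype.val h)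
        rw [SimpleGraph.dist_induce_of_parent_mem hG.connected hx hF, Real.rpow_neg hpos.le,
          Real.rpow_natCast, ← one_div, le_div_iff₀ (by positivity), mul_comm] at this
        rwa [← hg ⟨v, hvF⟩]
      · rw [hgF v hvF, mul_zero]
        exact zero_le_one
  · refine ⟨Set.univ, Set.mem_univ x, ⟨⟨x, Set.mem_univ x⟩, ?_, fun v _ => by simp⟩, ?_⟩
    · exact SimpleGraph.connected_induce_of_parent_mem hG.connected (Set.mem_univ x)
        fun v _ hv => by simpa using hG.connected.exists_mem_children hv
    · refine (Real.sSup_of_not_bddAbove fun h => hbdd (h.mono ?_)).le.trans (le_max_right _ _)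
      exact fun lam hlam =>
        ⟨hlam.1, SimpleGraph.exists_isAdmissibleFlow_induce_univ hG.connected hlam.2⟩
end
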